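/- arXiv:2312.15596 — 5 statements merged into one kernel-verified Lean document; each statement's English description precedes it below -/
import Mathlib

section
/- For a finite digraph G, the following are equivalent: (1) G is irreducible; (2) G is not strongly homomorphic to any of its proper subgraphs; (3) every strong homomorphism from G to another digraph is injective. -/
/-- An edge-labelled directed graph over vertex ambient type `α` and
label (access right) type `σ`: a vertex set `V` and an edge set
`E ⊆ V × σ × V`. -/
structure LDigraph (α σ : Type*) where
  V : Set α
  E : Set (α × σ × α)
  edge_mem : ∀ e ∈ E, e.1 ∈ V ∧ e.2.2 ∈ V

namespace LDigraph

variable {α β γ σ : Type*}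

/-- `π` is a strong homomorphism from `G` to `H`: it maps `V(G)` into `V(H)` and
`(u,a,v) ∈ E(G)` iff `(π u, a, π v) ∈ E(H)`. -/
def IsStrongHom (G : LDigraph α σ) (H : LDigraph β σ) (π : α → β) : Prop :=
  Set.MapsTo π G.V H.V ∧
    ∀ u ∈ G.V, ∀ v ∈ G.V, ∀ a : σ, (u, a, v) ∈ G.E ↔ (π u, a, π v) ∈ H.E

/-- `H'` is a subgraph of `H`. -/
def IsSubgraph (H' H : LDigraph α σ) : Prop :=
  H'.V ⊆ H.V ∧ H'.E ⊆ H.E ∩ {t | t.1 ∈ H'.V ∧ t.2.2 ∈ H'.V}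

/-- `H` is a summary of `G`: `G` is strongly homomorphic to `H`, but not to
any proper subgraph of `H`. -/
def IsSummary (G : LDigraph α σ) (H : LDigraph β σ) : Prop :=
  (∃ π : α → β, IsStrongHom G H π) ∧
    ∀ H' : LDigraph β σ, IsSubgraph H' H → H' ≠ H → ¬ ∃ π : α → β, IsStrongHom G H' π

/-- `G` and `H` are isomorphic: there is a strong homomorphism from `G` to `H`
that is a bijection from `V(G)` to `V(H)`. -/
def IsIsomorphic (G : LDigraph α σ) (H : LDigraph β σ) : Prop :=
  ∃ π : α → β, IsStrongHom G H π ∧ Set.BijOn π G.V H.V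

end LDigraph

namespace LDigraph

/-- A digraph `G` is irreducible iff every summary of `G` is isomorphic to `G`. -/
def IsIrreducible {α σ : Type*} (G : LDigraph α σ) : Prop :=
  ∀ H : LDigraph α σ, IsSummary G H → IsIsomorphic H G

universe u v

theorem aux_E_finite {α : Type u} {σ : Type v} [Finite σ] (G : LDigraph α σ)
    (hG : G.V.Finite) : G.E.Finite := by
  have : (G.V ×ˢ ((Set.univ : Set σ) ×ˢ G.V)).Finite :=
    hG.prod (Set.finite_univ.prod hG)
  refine this.subset ?_
  intro e he
  exact ⟨(G.edge_mem e he).1, Set.mem_univ _, (G.edge_mem e he).2⟩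

theorem aux_ext {α : Type u} {σ : Type v} {G H : LDigraph α σ} (hV : G.V = H.V)
    (hE : G.E = H.E) : G = H := by
  cases G; cases H; simp_all

theorem aux_eq {α : Type u} {σ : Type v} [Finite σ] {G H : LDigraph α σ}
    (hG : G.V.Finite) (hs : IsSubgraph H G) (hV : G.V.ncard ≤ H.V.ncard)
    (hE : G.E.ncard ≤ H.E.ncard) : H = G :=
  aux_ext (Set.eq_of_subset_of_ncard_le hs.1 hV hG)
    (Set.eq_of_subset_of_ncard_le (fun e he => (hs.2 he).1) hE (aux_E_finite G hG))

theorem aux_sub_trans {α : Type u} {σ : Type v} {G H K : LDigraph α σ}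
    (h1 : IsSubgraph K H) (h2 : IsSubgraph H G) : IsSubgraph K G :=
  ⟨h1.1.trans h2.1, fun e he => ⟨(h2.2 (h1.2 he).1).1, (h1.2 he).2⟩⟩

theorem aux_12 {α : Type u} {σ : Type v} [Finite σ]
    (G : LDigraph α σ) (hG : G.V.Finite) (h : IsIrreducible G) :
    ∀ H' : LDigraph α σ, IsSubgraph H' G → H' ≠ G →
        ¬ ∃ π : α → α, IsStrongHom G H' π := by
  let f : LDigraph α σ → ℕ := fun H => H.V.ncard + H.E.ncard
  obtain ⟨H, ⟨hHG, hHπ⟩, hmin⟩ := (measure f).wf.has_min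
    {H : LDigraph α σ | IsSubgraph H G ∧ ∃ π : α → α, IsStrongHom G H π}
    ⟨G, ⟨subset_rfl, fun e he => ⟨he, G.edge_mem e he⟩⟩, id, fun x hx => hx,
      fun u _ v _ a => Iff.rfl⟩
  have hHf : H.V.Finite := hG.subset hHG.1
  have hsum : IsSummary G H := by
    refine ⟨hHπ, fun H' hs hne hπ => ?_⟩
    have h1 : ¬ f H' < f H := hmin H' ⟨aux_sub_trans hs hHG, hπ⟩
    have h2 := Set.ncard_le_ncard hs.1 hHf
    have h3 := Set.ncard_le_ncard (fun e he => (hs.2 he).1 : H'.E ⊆ H.E) (aux_E_finite H hHf)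
    simp only [f] at h1
    exact hne (aux_eq hHf hs (by omega) (by omega))
  obtain ⟨π, hπ, hb⟩ := h H hsum
  have hEq : H = G := by
    refine aux_eq hG hHG ?_ ?_
    · rw [← hb.image_eq]
      exact Set.ncard_image_le hHf
    · have : G.E ⊆ (fun e : α × σ × α => (π e.1, e.2.1, π e.2.2)) '' H.E := by
        rintro ⟨x, a, y⟩ he
        obtain ⟨hx, hy⟩ := G.edge_mem _ he
        obtain ⟨x', hx', rfl⟩ := hb.surjOn hx
        obtain ⟨y', hy', rfl⟩ := hb.surjOn hy
        exact ⟨(x', a, y'), (hπ.2 x' hx' y' hy' a).2 he, rfl⟩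
      exact (Set.ncard_le_ncard this ((aux_E_finite H hHf).image _)).trans
        (Set.ncard_image_le (aux_E_finite H hHf))
  subst hEq
  exact hsum.2

theorem aux_23 {α : Type u} {σ : Type v} (G : LDigraph α σ)
    (h : ∀ H' : LDigraph α σ, IsSubgraph H' G → H' ≠ G →
        ¬ ∃ π : α → α, IsStrongHom G H' π) :
    ∀ (β : Type u) (H : LDigraph β σ) (π : α → β),
        IsStrongHom G H π → Set.InjOn π G.V := by
  classical
  intro β H π hπ u hu v hv huv
  by_contra hne
  let K : LDigraph α σ :=
    { V := G.V \ {u}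
      E := {e | e ∈ G.E ∧ e.1 ≠ u ∧ e.2.2 ≠ u}
      edge_mem := fun e he => ⟨⟨(G.edge_mem e he.1).1, he.2.1⟩,
        ⟨(G.edge_mem e he.1).2, he.2.2⟩⟩ }
  let r : α → α := fun x => if x = u then v else x
  have hr : ∀ x, π (r x) = π x := by
    intro x; by_cases hx : x = u <;> simp [r, hx, huv]
  have hru : ∀ x, r x ≠ u := by
    intro x; by_cases hx : x = u <;> simp [r, hx, Ne.symm hne]
  have hrV : ∀ x ∈ G.V, r x ∈ G.V := by
    intro x hx; by_cases hx' : x = u <;> simp [r, hx', hx, hv]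
  refine h K ⟨Set.sdiff_subset, fun e he => ⟨he.1, K.edge_mem e he⟩⟩ ?_ ⟨r, ?_, ?_⟩
  · intro hK
    rw [← hK] at hu
    exact hu.2 rfl
  · intro x hx
    exact ⟨hrV x hx, hru x⟩
  · intro x hx y hy a
    have : (x, a, y) ∈ G.E ↔ (r x, a, r y) ∈ G.E := by
      rw [hπ.2 x hx y hy, hπ.2 _ (hrV x hx) _ (hrV y hy), hr, hr]
    exact ⟨fun he => ⟨this.1 he, hru x, hru y⟩, fun he => this.2 he.1⟩

theorem aux_31 {α : Type u} {σ : Type v} (G : LDigraph α σ)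
    (h : ∀ (β : Type u) (H : LDigraph β σ) (π : α → β),
        IsStrongHom G H π → Set.InjOn π G.V) : IsIrreducible G := by
  rintro H ⟨⟨π, hπ⟩, hmin⟩
  have hinj := h α H π hπ
  let K : LDigraph α σ :=
    { V := π '' G.V
      E := {e | e ∈ H.E ∧ e.1 ∈ π '' G.V ∧ e.2.2 ∈ π '' G.V}
      edge_mem := fun e he => he.2 }
  have hK : K = H := by
    by_contra hne
    refine hmin K ⟨hπ.1.image_subset, fun e he => he⟩ hne ⟨π, Set.mapsTo_image _ _, ?_⟩
    intro u hu v hv a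
    rw [hπ.2 u hu v hv a]
    exact ⟨fun he => ⟨he, ⟨u, hu, rfl⟩, ⟨v, hv, rfl⟩⟩, fun he => he.1⟩
  have hV : π '' G.V = H.V := congrArg LDigraph.V hK
  have hb : Set.BijOn π G.V H.V := ⟨hπ.1, hinj, hV.symm.subset⟩
  rcases isEmpty_or_nonempty α with hα | hα
  · exact ⟨id, ⟨fun x => hα.elim x, fun u => hα.elim u⟩,
      fun x => hα.elim x, fun x => hα.elim x, fun x => hα.elim x⟩
  · have hinv := hb.invOn_invFunOn
    have hb' := Set.BijOn.symm hinv.symm hb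
    refine ⟨Function.invFunOn π G.V, ⟨hb'.mapsTo, ?_⟩, hb'⟩
    intro u hu v hv a
    rw [hπ.2 _ (hb'.mapsTo hu) _ (hb'.mapsTo hv), hinv.2 hu, hinv.2 hv]


/-- For a finite digraph `G`, TFAE:
(1) `G` is irreducible;
(2) `G` is not strongly homomorphic to any of its proper subgraphs;
(3) every strong homomorphism from `G` to another digraph is injective. -/
theorem irreducible_tfae {α : Type u} {σ : Type v} [Finite σ]
    (G : LDigraph α σ) (hG : G.V.Finite) :
    [ IsIrreducible G,
      ∀ H' : LDigraph α σ, IsSubgraph H' G → H' ≠ G →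
        ¬ ∃ π : α → α, IsStrongHom G H' π,
      ∀ (β : Type u) (H : LDigraph β σ) (π : α → β),
        IsStrongHom G H π → Set.InjOn π G.V ].TFAE := by
  tfae_have 1 → 2 := aux_12 G hG
  tfae_have 2 → 3 := aux_23 G
  tfae_have 3 → 1 := aux_31 G
  tfae_finish

end LDigraph
end

section
/- Suppose there is a surjective strong homomorphism from a finite digraph G to a finite digraph H. Then H is a summary of G if and only if H is irreducible. -/
namespace LDigraph

theorem ext' {α σ : Type*} {K L : LDigraph α σ} (h1 : K.V = L.V) (h2 : K.E = L.E) : K = L := by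
  cases K; cases L; simp_all

theorem IsStrongHom.comp {α β γ σ : Type*} {G : LDigraph α σ} {H : LDigraph β σ}
    {K : LDigraph γ σ} {f : β → γ} {g : α → β} (hf : IsStrongHom H K f)
    (hg : IsStrongHom G H g) : IsStrongHom G K (f ∘ g) :=
  ⟨hf.1.comp hg.1, fun u hu v hv a =>
    (hg.2 u hu v hv a).trans (hf.2 _ (hg.1 hu) _ (hg.1 hv) a)⟩

/-- induced subgraph on the image -/
def img {α β σ : Type*} (G : LDigraph α σ) (H : LDigraph β σ) (f : α → β) : LDigraph β σ where
  V := f '' G.V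
  E := {t | t ∈ H.E ∧ t.1 ∈ f '' G.V ∧ t.2.2 ∈ f '' G.V}
  edge_mem := fun _ h => h.2

theorem surj_of_summary {α β σ : Type*} {G : LDigraph α σ} {H : LDigraph β σ}
    (h : IsSummary G H) {f : α → β} (hf : IsStrongHom G H f) : Set.SurjOn f G.V H.V := by
  have key : img G H f = H := by
    by_contra hne
    refine h.2 (img G H f) ⟨hf.1.image_subset, fun t ht => ⟨ht.1, ht.2⟩⟩ hne ⟨f, ?_, ?_⟩
    · exact Set.mapsTo_image _ _
    · intro u hu v hv a
      rw [hf.2 u hu v hv a]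
      exact ⟨fun h => ⟨h, ⟨u, hu, rfl⟩, ⟨v, hv, rfl⟩⟩, fun h => h.1⟩
  intro y hy
  rw [← key] at hy
  exact hy

theorem section_strong {α β σ : Type*} [Nonempty α] {G : LDigraph α σ} {H : LDigraph β σ}
    {f : α → β} (hf : IsStrongHom G H f) (hs : Set.SurjOn f G.V H.V) :
    ∃ s : β → α, IsStrongHom H G s ∧ ∀ y ∈ H.V, f (s y) = y := by
  have h1 : ∀ y, ∃ x, y ∈ H.V → x ∈ G.V ∧ f x = y := by
    intro y
    by_cases hy : y ∈ H.V
    · obtain ⟨x, hx, e⟩ := hs hy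
      exact ⟨x, fun _ => ⟨hx, e⟩⟩
    · exact ⟨Classical.arbitrary α, fun h => absurd h hy⟩
  choose s hs using h1
  refine ⟨s, ⟨fun y hy => (hs y hy).1, ?_⟩, fun y hy => (hs y hy).2⟩
  intro u hu v hv a
  rw [hf.2 _ (hs u hu).1 _ (hs v hv).1 a, (hs u hu).2, (hs v hv).2]

theorem E_finite {α σ : Type*} [Finite σ] {G : LDigraph α σ} (hG : G.V.Finite) :
    G.E.Finite := by
  refine (hG.prod ((Set.finite_univ (α := σ)).prod hG)).subset ?_
  intro e he
  exact ⟨(G.edge_mem e he).1, trivial, (G.edge_mem e he).2⟩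

theorem IsSubgraph.eq_of_card {α σ : Type*} [Finite σ] {K L : LDigraph α σ}
    (h : IsSubgraph K L) (hL : L.V.Finite)
    (hc : L.V.ncard + L.E.ncard ≤ K.V.ncard + K.E.ncard) : K = L := by
  have hE : K.E ⊆ L.E := fun t ht => (h.2 ht).1
  have h1 := Set.ncard_le_ncard h.1 hL
  have h2 := Set.ncard_le_ncard hE (E_finite hL)
  exact ext' (Set.eq_of_subset_of_ncard_le h.1 (by omega) hL)
    (Set.eq_of_subset_of_ncard_le hE (by omega) (E_finite hL))

theorem IsSubgraph.trans' {α σ : Type*} {K L M : LDigraph α σ}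
    (h : IsSubgraph K L) (h' : IsSubgraph L M) : IsSubgraph K M :=
  ⟨h.1.trans h'.1, fun t ht => ⟨(h'.2 (h.2 ht).1).1, (h.2 ht).2⟩⟩

theorem exists_summary {α β σ : Type*} [Finite σ] (G : LDigraph α σ) (n : ℕ) :
    ∀ H : LDigraph β σ, H.V.Finite → H.V.ncard + H.E.ncard = n →
      (∃ f : α → β, IsStrongHom G H f) → ∃ K, IsSubgraph K H ∧ IsSummary G K := by
  induction n using Nat.strong_induction_on with
  | _ n ih =>
    intro H hH hn hf
    by_cases hs : IsSummary G H
    · exact ⟨H, ⟨subset_rfl, fun t ht => ⟨ht, H.edge_mem t ht⟩⟩, hs⟩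
    · simp only [IsSummary, not_and, not_forall, not_not] at hs
      obtain ⟨L, hL, hne, hg⟩ := hs hf
      have hlt : L.V.ncard + L.E.ncard < n := by
        by_contra hc
        exact hne (hL.eq_of_card hH (by omega))
      obtain ⟨K, hK, hKs⟩ := ih _ hlt L (hH.subset hL.1) rfl hg
      exact ⟨K, hK.trans' hL, hKs⟩

/-- Suppose there is a surjective strong homomorphism from a
finite digraph `G` to a finite digraph `H`. Then `H` is a summary of `G`
iff `H` is irreducible. -/
theorem isSummary_iff_irreducible {α β σ : Type*} [Finite σ]
    (G : LDigraph α σ) (H : LDigraph β σ)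
    (hG : G.V.Finite) (hH : H.V.Finite)
    (π : α → β) (hπ : IsStrongHom G H π) (hsurj : Set.SurjOn π G.V H.V) :
    IsSummary G H ↔ IsIrreducible H := by
  constructor
  · intro hS K hK
    obtain ⟨f, hf⟩ := hK.1
    have hfs := surj_of_summary hK hf
    rcases isEmpty_or_nonempty β with hβ | hβ
    · exact ⟨id, ⟨fun x => hβ.elim x, fun x => hβ.elim x⟩,
        fun x => hβ.elim x, fun x => hβ.elim x, fun x => hβ.elim x⟩
    obtain ⟨s, hs, hfx⟩ := section_strong hf hfs
    refine ⟨s, hs, hs.1, ?_, ?_⟩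
    · intro x hx y hy e
      rw [← hfx x hx, ← hfx y hy, e]
    · intro y hy
      obtain ⟨x, hx, e⟩ := surj_of_summary hS (hs.comp (hf.comp hπ)) hy
      exact ⟨f (π x), hf.1 (hπ.1 hx), e⟩
  · intro hI
    refine ⟨⟨π, hπ⟩, ?_⟩
    rintro H' hsub hne ⟨ρ, hρ⟩
    apply hne
    rcases H.V.eq_empty_or_nonempty with h0 | ⟨y, hy⟩
    · have e1 : H'.V = H.V := by
        rw [h0]; exact Set.subset_eq_empty hsub.1 h0
      refine ext' e1 (Set.Subset.antisymm (fun t ht => (hsub.2 ht).1) fun t ht => ?_)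
      have := (H.edge_mem t ht).1
      rw [h0] at this
      exact this.elim
    obtain ⟨x0, -, -⟩ := hsurj hy
    haveI : Nonempty α := ⟨x0⟩
    obtain ⟨s, hs, -⟩ := section_strong hπ hsurj
    have hH' := hH.subset hsub.1
    obtain ⟨K, hK, hKs⟩ := exists_summary H _ H' hH' rfl ⟨_, hρ.comp hs⟩
    obtain ⟨p, hp, hb⟩ := hI K hKs
    have hKf := hH'.subset hK.1
    have c1 : H.V.ncard ≤ K.V.ncard := by
      rw [← hb.image_eq]; exact Set.ncard_image_le hKf
    have c2 : H.E.ncard ≤ K.E.ncard := by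
      refine (Set.ncard_le_ncard (t := (fun t => (p t.1, t.2.1, p t.2.2)) '' K.E) ?_
        ((E_finite hKf).image _)).trans (Set.ncard_image_le (E_finite hKf))
      rintro ⟨u, a, v⟩ ht
      obtain ⟨hu, hv⟩ := H.edge_mem _ ht
      obtain ⟨u, hu2, rfl⟩ := hb.surjOn hu
      obtain ⟨v, hv2, rfl⟩ := hb.surjOn hv
      exact ⟨(u, a, v), (hp.2 u hu2 v hv2 a).2 ht, rfl⟩
    refine hsub.eq_of_card hH ?_
    have c3 := Set.ncard_le_ncard hK.1 hH'
    have c4 := Set.ncard_le_ncard (fun t ht => (hK.2 ht).1) (E_finite hH')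
    omega

end LDigraph
end

section
/- For any digraph G, the indistinguishability relation ≡_G is an equivalence relation on V(G). -/
namespace LDigraph

/-- Vertices `u` and `v` of `G` are indistinguishable (`u ≡_G v`): for every
label `a`, (1) the four edges `(u,a,u)`, `(u,a,v)`, `(v,a,u)`, `(v,a,v)` are
either all present or all absent, and (2) for every `x ∈ V(G) \ {u,v}`,
`(u,a,x) ∈ E(G)` iff `(v,a,x) ∈ E(G)`, and `(x,a,u) ∈ E(G)` iff `(x,a,v) ∈ E(G)`. -/
def Indist {α σ : Type*} (G : LDigraph α σ) (u v : α) : Prop :=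
  ∀ a : σ,
    (((u, a, u) ∈ G.E ∧ (u, a, v) ∈ G.E ∧ (v, a, u) ∈ G.E ∧ (v, a, v) ∈ G.E) ∨
     ((u, a, u) ∉ G.E ∧ (u, a, v) ∉ G.E ∧ (v, a, u) ∉ G.E ∧ (v, a, v) ∉ G.E)) ∧
    ∀ x ∈ G.V, x ≠ u → x ≠ v →
      (((u, a, x) ∈ G.E ↔ (v, a, x) ∈ G.E) ∧ ((x, a, u) ∈ G.E ↔ (x, a, v) ∈ G.E))

end LDigraph

namespace LDigraph

theorem indist_iff_aux {α σ : Type*} (G : LDigraph α σ) (u v : α) (hu : u ∈ G.V) (hv : v ∈ G.V) :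
    Indist G u v ↔ ∀ a : σ, ∀ x ∈ G.V,
      (((u, a, x) ∈ G.E ↔ (v, a, x) ∈ G.E) ∧ ((x, a, u) ∈ G.E ↔ (x, a, v) ∈ G.E)) := by
  constructor
  · intro h a x hx
    obtain ⟨h1, h2⟩ := h a
    by_cases e1 : x = u
    · subst e1; tauto
    by_cases e2 : x = v
    · subst e2; tauto
    exact h2 x hx e1 e2
  · intro h a
    have h1 := h a u hu
    have h2 := h a v hv
    exact ⟨by tauto, fun x hx _ _ => h a x hx⟩

/-- For any digraph `G`, the indistinguishability relation
`≡_G` is an equivalence relation on `V(G)`. -/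
theorem indist_equivalence {α σ : Type*} (G : LDigraph α σ) :
    Equivalence (fun u v : G.V => Indist G u.1 v.1) := by
  refine ⟨fun u => ?_, fun {u v} h => ?_, fun {u v w} h k => ?_⟩
  · exact (indist_iff_aux G _ _ u.2 u.2).2 fun a x _ => ⟨Iff.rfl, Iff.rfl⟩
  · have h' := (indist_iff_aux G _ _ u.2 v.2).1 h
    exact (indist_iff_aux G _ _ v.2 u.2).2 fun a x hx =>
      ⟨(h' a x hx).1.symm, (h' a x hx).2.symm⟩
  · have h' := (indist_iff_aux G _ _ u.2 v.2).1 h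
    have k' := (indist_iff_aux G _ _ v.2 w.2).1 k
    exact (indist_iff_aux G _ _ u.2 w.2).2 fun a x hx =>
      ⟨(h' a x hx).1.trans (k' a x hx).1, (h' a x hx).2.trans (k' a x hx).2⟩

end LDigraph
end

section
/- For every finite digraph G, the quotient digraph Sum(G) is the summary of G; in particular, the map sending each vertex v ∈ V(G) to its equivalence class [v]_≡ is a strong homomorphism from G to Sum(G), and G is not strongly homomorphic to any proper subgraph of Sum(G). -/
namespace LDigraph

/-- The equivalence class `[v]_≡` of `v` under indistinguishability in `G`. -/
def cls {α σ : Type*} (G : LDigraph α σ) (v : α) : Set α :=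
  {u | u ∈ G.V ∧ Indist G u v}

/-- The quotient digraph `Sum(G)`, whose vertices are the equivalence classes
`[v]_≡` for `v ∈ V(G)`, and whose edges are `([u]_≡, a, [v]_≡)` for
`(u,a,v) ∈ E(G)`. -/
def SumG {α σ : Type*} (G : LDigraph α σ) : LDigraph (Set α) σ where
  V := cls G '' G.V
  E := {t | ∃ u v a, (u, a, v) ∈ G.E ∧ t = (cls G u, a, cls G v)}
  edge_mem := by
    rintro t ⟨u, v, a, he, rfl⟩
    exact ⟨⟨u, (G.edge_mem _ he).1, rfl⟩, ⟨v, (G.edge_mem _ he).2, rfl⟩⟩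

/-- Twin characterization of indistinguishability. -/
theorem indist_iff_twin {α σ : Type*} (G : LDigraph α σ) {u v : α} (hu : u ∈ G.V) (hv : v ∈ G.V) :
    Indist G u v ↔ ∀ a : σ, ∀ x ∈ G.V,
      (((u, a, x) ∈ G.E ↔ (v, a, x) ∈ G.E) ∧ ((x, a, u) ∈ G.E ↔ (x, a, v) ∈ G.E)) := by
  constructor
  · intro h a x hx
    obtain ⟨h1, h2⟩ := h a
    by_cases hxu : x = u
    · subst hxu; tauto
    by_cases hxv : x = v
    · subst hxv; tauto
    exact h2 x hx hxu hxv
  · intro h a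
    have h1 := h a u hu
    have h2 := h a v hv
    exact ⟨by tauto, fun x hx _ _ => h a x hx⟩

theorem cls_eq_iff {α σ : Type*} (G : LDigraph α σ) {u v : α} (hu : u ∈ G.V) (hv : v ∈ G.V) :
    cls G u = cls G v ↔ ∀ a : σ, ∀ x ∈ G.V,
      (((u, a, x) ∈ G.E ↔ (v, a, x) ∈ G.E) ∧ ((x, a, u) ∈ G.E ↔ (x, a, v) ∈ G.E)) := by
  constructor
  · intro h
    have : u ∈ cls G u := ⟨hu, (indist_iff_twin G hu hu).2 (fun _ _ _ => ⟨Iff.rfl, Iff.rfl⟩)⟩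
    rw [h] at this
    exact (indist_iff_twin G hu hv).1 this.2
  · intro h
    ext w
    refine and_congr_right fun hw => ?_
    rw [indist_iff_twin G hw hu, indist_iff_twin G hw hv]
    refine forall_congr' fun a => forall_congr' fun x => forall_congr' fun hx => ?_
    rw [(h a x hx).1, (h a x hx).2]

theorem cls_strongHom {α σ : Type*} (G : LDigraph α σ) : IsStrongHom G (SumG G) (cls G) := by
  refine ⟨fun v hv => ⟨v, hv, rfl⟩, fun u hu v hv a => ⟨fun h => ⟨u, v, a, h, rfl⟩, ?_⟩⟩
  rintro ⟨u', v', a', h, e⟩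
  simp only [Prod.mk.injEq] at e
  obtain ⟨e1, rfl, e2⟩ := e
  have hm := G.edge_mem _ h
  have t1 := (cls_eq_iff G hu hm.1).1 e1
  have t2 := (cls_eq_iff G hv hm.2).1 e2
  rw [(t1 a v hv).1, (t2 a u' hm.1).2]
  exact h

theorem eq_of_inj_between {β : Type*} {S T : Set β} (hS : S.Finite) (f : β → β)
    (hf : Set.InjOn f S) (hm : Set.MapsTo f S T) (hT : T ⊆ S) : T = S := by
  apply Set.eq_of_subset_of_ncard_le hT _ hS
  rw [← Set.ncard_image_of_injOn hf]
  exact Set.ncard_le_ncard hm.image_subset (hS.subset hT)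

theorem no_proper {α σ : Type*} [Finite σ] (G : LDigraph α σ) (hG : G.V.Finite)
    (H' : LDigraph (Set α) σ) (hs : IsSubgraph H' (SumG G)) (π : α → Set α)
    (hπ : IsStrongHom G H' π) : H' = SumG G := by
  classical
  have hSf : (SumG G).V.Finite := hG.image _
  have hg : ∀ c : Set α, ∃ d : Set α, c ∈ (SumG G).V → ∃ r ∈ G.V, cls G r = c ∧ d = π r := by
    intro c
    by_cases hc : c ∈ (SumG G).V
    · obtain ⟨r, h1, h2⟩ := hc
      exact ⟨π r, fun _ => ⟨r, h1, h2, rfl⟩⟩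
    · exact ⟨∅, fun h => absurd h hc⟩
  choose g hg using hg
  have hinj : Set.InjOn g (SumG G).V := by
    intro c hc d hd h
    obtain ⟨r, hr, rc, e1⟩ := hg c hc
    obtain ⟨s, hs, sd, e2⟩ := hg d hd
    have e : π r = π s := by rw [← e1, ← e2, h]
    rw [← rc, ← sd, cls_eq_iff G hr hs]
    intro a x hx
    rw [hπ.2 r hr x hx, hπ.2 s hs x hx, hπ.2 x hx r hr, hπ.2 x hx s hs, e]
    exact ⟨Iff.rfl, Iff.rfl⟩
  have hmaps : Set.MapsTo g (SumG G).V H'.V := by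
    intro c hc
    obtain ⟨r, hr, rc, e1⟩ := hg c hc
    rw [e1]
    exact hπ.1 hr
  have hV : H'.V = (SumG G).V := eq_of_inj_between hSf g hinj hmaps hs.1
  have hEf : (SumG G).E.Finite := by
    refine (hSf.prod ((Set.finite_univ (α := σ)).prod hSf)).subset ?_
    intro t ht
    have := (SumG G).edge_mem t ht
    exact ⟨this.1, Set.mem_univ _, this.2⟩
  have hE : H'.E = (SumG G).E := by
    refine eq_of_inj_between hEf (fun t => (g t.1, t.2.1, g t.2.2)) ?_ ?_
      (fun t ht => (hs.2 ht).1)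
    · rintro ⟨c, a, d⟩ h1 ⟨c', a', d'⟩ h2 h
      have m1 := (SumG G).edge_mem _ h1
      have m2 := (SumG G).edge_mem _ h2
      simp only [Prod.mk.injEq] at h ⊢
      exact ⟨hinj m1.1 m2.1 h.1, h.2.1, hinj m1.2 m2.2 h.2.2⟩
    · rintro ⟨c, a, d⟩ h1
      have m1 := (SumG G).edge_mem _ h1
      obtain ⟨r, hr, rc, e1⟩ := hg c m1.1
      obtain ⟨s, hs', sd, e2⟩ := hg d m1.2
      change (g c, a, g d) ∈ H'.E
      rw [e1, e2, ← hπ.2 r hr s hs' a, (cls_strongHom G).2 r hr s hs' a, rc, sd]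
      exact h1
  cases H'
  cases hq : SumG G
  rw [hq] at hV hE
  simp only at hV hE
  subst hV hE
  rfl

/-- For every finite digraph `G`, the quotient digraph
`Sum(G)` is the summary of `G`; in particular, the map `v ↦ [v]_≡` is a strong
homomorphism from `G` to `Sum(G)`, and `G` is not strongly homomorphic to any
proper subgraph of `Sum(G)`. -/
theorem sumG_isSummary {α σ : Type*} [Finite σ]
    (G : LDigraph α σ) (hG : G.V.Finite) :
    IsSummary G (SumG G) ∧
    IsStrongHom G (SumG G) (cls G) ∧
    ∀ H' : LDigraph (Set α) σ, IsSubgraph H' (SumG G) → H' ≠ SumG G →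
      ¬ ∃ π : α → Set α, IsStrongHom G H' π := by
  have key : ∀ H' : LDigraph (Set α) σ, IsSubgraph H' (SumG G) → H' ≠ SumG G →
      ¬ ∃ π : α → Set α, IsStrongHom G H' π := by
    rintro H' hs hne ⟨π, hπ⟩
    exact hne (no_proper G hG H' hs π hπ)
  exact ⟨⟨⟨cls G, cls_strongHom G⟩, key⟩, cls_strongHom G, key⟩

end LDigraph
end

section
/- Let M be an access control matrix for a finite entity set E and let DTP = (D, T, δ, τ, tbl) be a domain and type enforcement policy that enforces M. Then |D| ≥ r(M) and |T| ≥ c(M). -/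
/-- The number of equivalence classes induced by a relation `r` on `E`:
the cardinality of the set of classes `{ {v | r u v} : u ∈ E }`. -/
noncomputable def numClasses {E : Type*} (r : E → E → Prop) : ℕ :=
  Nat.card (Set.range fun u => {v | r u v})

/-- Row equivalence `u ≡_row v` for an access control matrix `M`:
`M[u,a,x] = M[v,a,x]` for every `x` and `a`. -/
def rowEquiv {E A : Type*} (M : E → A → E → Bool) (u v : E) : Prop :=
  ∀ a : A, ∀ x : E, M u a x = M v a x

/-- Column equivalence `u ≡_col v` for an access control matrix `M`:
`M[x,a,u] = M[x,a,v]` for every `x` and `a`. -/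
def colEquiv {E A : Type*} (M : E → A → E → Bool) (u v : E) : Prop :=
  ∀ a : A, ∀ x : E, M x a u = M x a v

/-- Indistinguishability `u ≡ v` for an access control matrix `M`: for every
`a`, the four entries `M[u,a,u]`, `M[u,a,v]`, `M[v,a,u]`, `M[v,a,v]` are all
`1` or all `0`, and for every `x ∉ {u,v}`, `M[u,a,x] = M[v,a,x]` and
`M[x,a,u] = M[x,a,v]`. -/
def indistM {E A : Type*} (M : E → A → E → Bool) (u v : E) : Prop :=
  ∀ a : A,
    ((M u a u = true ∧ M u a v = true ∧ M v a u = true ∧ M v a v = true) ∨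
     (M u a u = false ∧ M u a v = false ∧ M v a u = false ∧ M v a v = false)) ∧
    ∀ x : E, x ≠ u → x ≠ v → (M u a x = M v a x ∧ M x a u = M x a v)

/-- A domain and type enforcement policy `(D, T, δ, τ, tbl)` enforces `M`:
for every `u, v ∈ E` and `a ∈ Σ`, `M[u,a,v] = 1` iff `tbl[δ(u), a, τ(v)] = 1`. -/
def EnforcesDTE {E A D T : Type*} (M : E → A → E → Bool)
    (δ : E → D) (τ : E → T) (tbl : D → A → T → Bool) : Prop :=
  ∀ u v : E, ∀ a : A, (M u a v = true ↔ tbl (δ u) a (τ v) = true)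

theorem numClasses_le_aux {E D : Type*} [Finite D] (r : E → E → Prop) (f : E → D)
    (h : ∀ u v, f u = f v → ∀ w, r u w ↔ r v w) : numClasses r ≤ Nat.card D := by
  unfold numClasses
  refine Nat.card_le_card_of_injective
    (fun c : Set.range fun u => {v | r u v} => f c.2.choose) ?_
  intro c d hcd
  apply Subtype.ext
  rw [← c.2.choose_spec, ← d.2.choose_spec]
  exact Set.ext fun w => h _ _ hcd w

/-- If a domain and type enforcement policy
`DTP = (D, T, δ, τ, tbl)` enforces the access control matrix `M`, then
`|D| ≥ r(M)` and `|T| ≥ c(M)`. -/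
theorem card_ge_of_enforces {E A D T : Type*} [Finite E] [Finite A]
    [Finite D] [Finite T]
    (M : E → A → E → Bool) (δ : E → D) (τ : E → T) (tbl : D → A → T → Bool)
    (h : EnforcesDTE M δ τ tbl) :
    numClasses (rowEquiv M) ≤ Nat.card D ∧ numClasses (colEquiv M) ≤ Nat.card T := by
  have h' : ∀ u a v, M u a v = tbl (δ u) a (τ v) := fun u a v =>
    Bool.eq_iff_iff.mpr (h u v a)
  refine ⟨numClasses_le_aux _ δ ?_, numClasses_le_aux _ τ ?_⟩
  · intro u v huv w
    simp only [rowEquiv, h', huv]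
  · intro u v huv w
    simp only [colEquiv, h', huv]
end
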